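/- Let k be a commutative artinian ring and let Λ be a k-algebra that is finitely generated as a k-module (an Artin algebra), and assume Λ satisfies Auslander's condition (AC). If Λ has finite injective dimension as a left module over itself, then: (1) Λ has finite injective dimension as a right module over itself (i.e., as a left Λᵒᵖ-module); and (2) the finitistic dimension of Λ is finite on both sides, i.e., there exists an integer n such that every finitely generated left Λ-module of finite projective dimension has projective dimension at most n, and likewise for finitely generated right Λ-modules. -/

import Mathlib

open CategoryTheory

universe u

noncomputable abbrev ExtGroup {A : Type u} [Ring A] (M N : ModuleCat.{u} A) (i : ℕ) :=
  ((Ext ℤ (ModuleCat.{u} A) i).obj (Opposite.op M)).obj N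

/-- Auslander's condition (AC). -/
def SatisfiesAC (A : Type u) [Ring A] : Prop :=
  ∀ M : ModuleCat.{u} A, Module.Finite A M →
    ∃ b : ℕ, ∀ N : ModuleCat.{u} A, Module.Finite A N →
      (∃ n : ℕ, ∀ i ≥ n, Subsingleton (ExtGroup M N i)) →
      ∀ i > b, Subsingleton (ExtGroup M N i)

/-- `N` has injective dimension at most `n`, characterized by vanishing of
`Ext^i(-, N)` for all `i > n`. -/
def InjDimLE {A : Type u} [Ring A] (N : ModuleCat.{u} A) (n : ℕ) : Prop :=
  ∀ M : ModuleCat.{u} A, ∀ i > n, Subsingleton (ExtGroup M N i)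

/-- `M` has projective dimension at most `n`, characterized by vanishing of
`Ext^i(M, -)` for all `i > n`. -/
def ProjDimLE {A : Type u} [Ring A] (M : ModuleCat.{u} A) (n : ℕ) : Prop :=
  ∀ N : ModuleCat.{u} A, ∀ i > n, Subsingleton (ExtGroup M N i)

/-- The (left) finitistic dimension of `A` is finite: there is a uniform bound on
the projective dimensions of the finitely generated left `A`-modules of finite
projective dimension. -/
def FiniteFinitisticDim (A : Type u) [Ring A] : Prop :=
  ∃ n : ℕ, ∀ M : ModuleCat.{u} A, Module.Finite A M →
    (∃ m : ℕ, ProjDimLE M m) → ProjDimLE M n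

section Bridge

variable {A : Type u} [Ring A]

theorem subsingleton_extGroup_succ_iff (M N : ModuleCat.{u} A) (n : ℕ) :
    Subsingleton (ExtGroup M N (n + 1)) ↔ Subsingleton (Abelian.Ext.{u} M N (n + 1)) := by
  let P := projectiveResolution M
  have key : Subsingleton (ExtGroup M N (n + 1)) ↔
      ∀ f : P.complex.X (n + 1) ⟶ N, P.complex.d (n + 2) (n + 1) ≫ f = 0 →
        ∃ g : P.complex.X n ⟶ N, P.complex.d (n + 1) n ≫ g = f := by
    rw [← ModuleCat.isZero_iff_subsingleton, (P.isoExt (R := ℤ) (n + 1) N).isZero_iff,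
      ← HomologicalComplex.exactAt_iff_isZero_homology,
      HomologicalComplex.exactAt_iff' _ n (n + 1) (n + 2) (by simp) (by simp),
      ShortComplex.moduleCat_exact_iff]
    rfl
  rw [key]
  constructor
  · intro h
    refine ⟨fun a b => ?_⟩
    have hz : ∀ x : Abelian.Ext.{u} M N (n + 1), x = 0 := by
      intro x
      obtain ⟨f, hf, rfl⟩ := P.extMk_surjective x (n + 2) rfl
      rw [P.extMk_eq_zero_iff f (n + 2) rfl hf n rfl]
      exact h f hf
    rw [hz a, hz b]
  · intro h f hf
    rw [← P.extMk_eq_zero_iff f (n + 2) rfl hf n rfl]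
    exact Subsingleton.elim _ _

end Bridge

section Homological

variable {A : Type u} [Ring A]

open Abelian

theorem exists_shortExact_finite_free [IsNoetherianRing A] (X : ModuleCat.{u} A)
    [Module.Finite A X] :
    ∃ S : ShortComplex (ModuleCat.{u} A), S.ShortExact ∧ Module.Free A S.X₂ ∧
      Module.Finite A S.X₂ ∧ Module.Finite A S.X₁ ∧ S.X₃ = X := by
  obtain ⟨n, f, hf⟩ := Module.Finite.exists_fin' A X
  exact ⟨f.shortComplexKer, LinearMap.shortExact_shortComplexKer hf,
    inferInstanceAs (Module.Free A (Fin n → A)), inferInstanceAs (Module.Finite A (Fin n → A)),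
    inferInstanceAs (Module.Finite A (LinearMap.ker f)), rfl⟩

theorem projective_of_free (F : ModuleCat.{u} A) [Module.Free A F] : Projective F :=
  ModuleCat.projective_of_free (Module.Free.chooseBasis A F)

theorem hasProjectiveDimensionLT_of_subsingleton_ext [IsNoetherianRing A]
    (P : ModuleCat.{u} A → Prop)
    (hP : ∀ S : ShortComplex (ModuleCat.{u} A), S.ShortExact → Module.Free A S.X₂ →
      Module.Finite A S.X₂ → P S.X₃ → P S.X₁)
    (b : ℕ) (X : ModuleCat.{u} A) [Module.Finite A X] (hX : P X)
    (h : ∀ N : ModuleCat.{u} A, Module.Finite A N → P N → Subsingleton (Ext.{u} X N (b + 1))) :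
    HasProjectiveDimensionLT X (b + 1) := by
  induction b generalizing X with
  | zero =>
    obtain ⟨S, hS, _, _, _, rfl⟩ := exists_shortExact_finite_free X
    have := h S.X₁ ‹_› (hP S hS ‹_› ‹_› hX)
    obtain ⟨x, hx⟩ := Ext.covariant_sequence_exact₃ S.X₃ hS (Ext.mk₀ (𝟙 S.X₃)) (zero_add 1)
      (Subsingleton.elim _ _)
    obtain ⟨s, rfl⟩ := Ext.homEquiv₀.symm.surjective x
    have hs : s ≫ S.g = 𝟙 S.X₃ := by
      apply Ext.homEquiv₀.symm.injective
      simpa using hx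
    have := projective_of_free S.X₂
    exact (Retract.mk s S.g hs).hasProjectiveDimensionLT 1
  | succ b ih =>
    obtain ⟨S, hS, _, _, _, rfl⟩ := exists_shortExact_finite_free X
    have := projective_of_free S.X₂
    have : HasProjectiveDimensionLT S.X₁ (b + 1) := by
      refine ih S.X₁ (hP S hS ‹_› ‹_› hX) fun N _ hN => ?_
      have := h N ‹_› hN
      have hz : ∀ x : Ext.{u} S.X₁ N (b + 1), x = 0 := by
        intro x
        obtain ⟨y, rfl⟩ := Ext.contravariant_sequence_exact₁ hS N x (n₁ := b + 1 + 1)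
          (add_comm _ _) (Subsingleton.elim _ _)
        rw [y.eq_zero_of_projective, Ext.comp_zero]
      exact ⟨fun x y => by rw [hz x, hz y]⟩
    exact (hS.hasProjectiveDimensionLT_X₃_iff b ‹_›).2 this

theorem hasInjectiveDimensionLT_fin_fun (n : ℕ)
    [HasInjectiveDimensionLT (ModuleCat.of A A) n] (r : ℕ) :
    HasInjectiveDimensionLT (ModuleCat.of A (Fin r → A)) n := by
  induction r with
  | zero =>
    have h : HasInjectiveDimensionLT (ModuleCat.of A (Fin 0 → A)) 0 :=
      (ModuleCat.isZero_of_subsingleton _).hasInjectiveDimensionLT_zero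
    exact hasInjectiveDimensionLT_of_ge _ 0 n (Nat.zero_le n)
  | succ r ih =>
    have e : ModuleCat.of A (A × (Fin r → A)) ≅ ModuleCat.of A (Fin (r + 1) → A) :=
      (Fin.consLinearEquiv A (fun _ : Fin (r + 1) => A)).toModuleIso
    have e' : ModuleCat.of A (A × (Fin r → A)) ≅ ModuleCat.of A A ⊞ ModuleCat.of A (Fin r → A) :=
      (ModuleCat.biprodIsoProd (ModuleCat.of A A) (ModuleCat.of A (Fin r → A))).symm
    exact hasInjectiveDimensionLT_of_iso (e'.symm ≪≫ e) n

theorem hasInjectiveDimensionLT_of_free (n : ℕ)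
    [HasInjectiveDimensionLT (ModuleCat.of A A) n] (F : ModuleCat.{u} A) [Module.Free A F]
    [Module.Finite A F] : HasInjectiveDimensionLT F n := by
  let b := Module.Free.chooseBasis A F
  let e := b.equivFun.trans (LinearEquiv.funCongrLeft A A (Fintype.equivFin _).symm)
  have := hasInjectiveDimensionLT_fin_fun (A := A) n
  exact hasInjectiveDimensionLT_of_iso e.toModuleIso.symm n

theorem hasProjectiveDimensionLT_of_hasInjectiveDimensionLT_self [IsNoetherianRing A] (n m : ℕ)
    [HasInjectiveDimensionLT (ModuleCat.of A A) (n + 1)] (M : ModuleCat.{u} A)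
    [Module.Finite A M] [HasProjectiveDimensionLT M m] : HasProjectiveDimensionLT M (n + 1) := by
  have key : ∀ j i : ℕ, m ≤ i + j → n + 1 ≤ i → ∀ N : ModuleCat.{u} A, Module.Finite A N →
      ∀ x : Ext.{u} M N i, x = 0 := by
    intro j
    induction j with
    | zero => exact fun i hi _ N _ x => x.eq_zero_of_hasProjectiveDimensionLT m hi
    | succ j ih =>
      intro i hi hni N _ x
      obtain ⟨S, hS, _, _, _, rfl⟩ := exists_shortExact_finite_free N
      obtain ⟨y, rfl⟩ := Ext.covariant_sequence_exact₃ M hS x rfl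
        (ih (i + 1) (by lia) (by lia) _ ‹_› _)
      have := hasInjectiveDimensionLT_of_free (n + 1) S.X₂
      rw [y.eq_zero_of_hasInjectiveDimensionLT (n + 1) hni, Ext.zero_comp]
  refine hasProjectiveDimensionLT_of_subsingleton_ext (fun _ => True) (fun _ _ _ _ _ => trivial)
    n M trivial fun N _ _ => ⟨fun x y => ?_⟩
  rw [key m (n + 1) (by lia) le_rfl N ‹_› x, key m (n + 1) (by lia) le_rfl N ‹_› y]

end Homological

section InjectiveCogenerator

variable {k : Type u} [CommRing k]

/-- Every simple `k`-module occurs at most once in the socle of `W`. -/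
def SocleMultiplicityFree (k : Type u) [CommRing k] (W : Type u) [AddCommGroup W] [Module k W] :
    Prop :=
  ∀ (T : Type u) [AddCommGroup T] [Module k T], IsSimpleModule k T →
    Module.length k (T →ₗ[k] W) ≤ 1

theorem SocleMultiplicityFree.length_linearMap_le {W : Type u} [AddCommGroup W] [Module k W]
    (hW : SocleMultiplicityFree k W) {M : Type u} [AddCommGroup M] [Module k M]
    (hM : IsFiniteLength k M) : Module.length k (M →ₗ[k] W) ≤ Module.length k M := by
  induction hM with
  | of_subsingleton => simp
  | @of_simple_quotient M _ _ N hs _ ih =>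
    have h : Module.length k (M →ₗ[k] W) ≤
        Module.length k ((M ⧸ N) →ₗ[k] W) + Module.length k (N →ₗ[k] W) := by
      let f : ((M ⧸ N) →ₗ[k] W) →ₗ[k] (M →ₗ[k] W) := LinearMap.lcomp k W N.mkQ
      let g : (M →ₗ[k] W) →ₗ[k] (N →ₗ[k] W) := LinearMap.lcomp k W N.subtype
      have hf : Function.Injective f := by
        intro a b hab
        ext x
        exact LinearMap.congr_fun hab x
      have hfg : Function.Exact f g.rangeRestrict := by
        intro a
        constructor
        · intro ha
          have ha' : g a = 0 := congrArg Subtype.val ha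
          refine ⟨N.liftQ a fun x hx => LinearMap.congr_fun ha' ⟨x, hx⟩, ?_⟩
          ext x
          rfl
        · rintro ⟨a, rfl⟩
          ext x
          change a (Submodule.Quotient.mk x) = 0
          rw [(Submodule.Quotient.mk_eq_zero N).2 x.2, map_zero]
      rw [Module.length_eq_add_of_exact f g.rangeRestrict hf g.surjective_rangeRestrict hfg]
      gcongr
      exact Module.length_le_of_injective (LinearMap.range g).subtype Subtype.val_injective
    have h' : Module.length k M = Module.length k N + Module.length k (M ⧸ N) :=
      Module.length_eq_add_of_exact N.subtype N.mkQ Subtype.val_injective N.mkQ_surjective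
        (LinearMap.exact_subtype_mkQ N)
    rw [h', Module.length_eq_one k (M ⧸ N), add_comm]
    exact h.trans (add_le_add (hW _ hs) ih) |>.trans (by rw [add_comm])

theorem SocleMultiplicityFree.length_le [IsArtinianRing k] {W : Type u} [AddCommGroup W]
    [Module k W] (hW : SocleMultiplicityFree k W) : Module.length k W ≤ Module.length k k := by
  rw [← (LinearMap.ringLmapEquivSelf k k W).length_eq]
  exact hW.length_linearMap_le (Module.length_ne_top_iff.1 Module.length_ne_top)

theorem exists_maximal_disjoint {Q : Type u} [AddCommGroup Q] [Module k Q] (W : Submodule k Q) :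
    ∃ N : Submodule k Q, Disjoint N W ∧ ∀ N', Disjoint N' W → N ≤ N' → N' = N := by
  obtain ⟨N, hN⟩ := zorn_le₀ {N : Submodule k Q | Disjoint N W} fun c hc hchain =>
    ⟨sSup c, hchain.directedOn.disjoint_sSup_left.2 hc, fun _ => le_sSup⟩
  exact ⟨N, hN.prop, fun N' h hle => (hN.eq_of_le h hle).symm⟩

variable (k) in
theorem exists_socleMultiplicityFree_length_maximal [IsArtinianRing k] :
    ∃ (E : Type u) (_ : AddCommGroup E) (_ : Module k E), SocleMultiplicityFree k E ∧
      ∀ (W : Type u) [AddCommGroup W] [Module k W], SocleMultiplicityFree k W →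
        Module.length k W ≤ Module.length k E := by
  let s : Set ℕ∞ := {l | ∃ (E : Type u) (_ : AddCommGroup E) (_ : Module k E),
    SocleMultiplicityFree k E ∧ Module.length k E = l}
  have hs : s.Nonempty := by
    refine ⟨_, PUnit.{u + 1}, inferInstance, inferInstance, fun T _ _ _ => ?_, rfl⟩
    simp
  have := hs.to_subtype
  have hlt : sSup s < ⊤ := by
    refine lt_of_le_of_lt (sSup_le ?_) (Module.length_ne_top (R := k) (M := k)).lt_top
    rintro _ ⟨E, _, _, hE, rfl⟩
    exact hE.length_le
  obtain ⟨E, i, j, hE, h⟩ := ENat.sSup_mem_of_nonempty_of_lt_top hlt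
  refine ⟨E, i, j, hE, fun W _ _ hW => ?_⟩
  rw [h]
  exact le_sSup ⟨W, _, _, hW, rfl⟩

variable {E : Type u} [AddCommGroup E] [Module k E]

theorem length_linearMap_simple_le_one {T S : Type u} [AddCommGroup T] [Module k T]
    [AddCommGroup S] [Module k S] [IsSimpleModule k T] [IsSimpleModule k S] :
    Module.length k (T →ₗ[k] S) ≤ 1 := by
  have := IsSimpleModule.nontrivial k T
  obtain ⟨x, hx⟩ := exists_ne (0 : T)
  have hinj : Function.Injective (LinearMap.applyₗ (R := k) (M₂ := S) x) := by
    intro f g hfg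
    refine LinearMap.ext_on (IsSimpleModule.span_singleton_eq_top k hx) ?_
    rintro _ rfl
    exact hfg
  simpa [Module.length_eq_one k S] using Module.length_le_of_injective _ hinj

theorem exists_ne_zero_of_length_maximal (hE : SocleMultiplicityFree k E)
    (hE_fin : Module.length k E ≠ ⊤)
    (hmax : ∀ (W : Type u) [AddCommGroup W] [Module k W], SocleMultiplicityFree k W →
        Module.length k W ≤ Module.length k E)
    (T : Type u) [AddCommGroup T] [Module k T] [IsSimpleModule k T] :
    ∃ f : T →ₗ[k] E, f ≠ 0 := by
  by_contra! h
  have hTE : SocleMultiplicityFree k (T × E) := by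
    intro S _ _ hS
    rw [← (LinearMap.prodEquiv k (M := S) (M₂ := T) (M₃ := E)).length_eq, Module.length_prod]
    rcases subsingleton_or_nontrivial (S →ₗ[k] T) with hST | hST
    · simpa using hE S hS
    · obtain ⟨f, hf⟩ := exists_ne (0 : S →ₗ[k] T)
      let e := LinearEquiv.ofBijective f (f.bijective_of_ne_zero hf)
      have : Subsingleton (S →ₗ[k] E) := by
        refine ⟨fun a b => ?_⟩
        have h0 : ∀ a : S →ₗ[k] E, a = 0 := fun a => by
          have := h (a ∘ₗ e.symm.toLinearMap)
          ext x
          simpa using LinearMap.congr_fun this (e x)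
        rw [h0 a, h0 b]
      simpa using length_linearMap_simple_le_one
  have := hmax _ hTE
  rw [Module.length_prod, Module.length_eq_one k T] at this
  lift Module.length k E to ℕ using hE_fin with n
  norm_cast at this
  lia

theorem injective_of_length_maximal (hE : SocleMultiplicityFree k E)
    (hE_fin : Module.length k E ≠ ⊤)
    (hmax : ∀ (W : Type u) [AddCommGroup W] [Module k W], SocleMultiplicityFree k W →
        Module.length k W ≤ Module.length k E) :
    Module.Injective k E := by
  obtain ⟨J⟩ := EnoughInjectives.presentation (ModuleCat.of k E)
  obtain ⟨Q, hQ, i, hi⟩ := J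
  have hi' : Function.Injective i.hom := (ModuleCat.mono_iff_injective i).1 hi
  obtain ⟨N, hN, hNmax⟩ := exists_maximal_disjoint (LinearMap.range i.hom)
  let p : E →ₗ[k] (Q ⧸ N) := N.mkQ ∘ₗ i.hom
  have hp : Function.Injective p := by
    rw [← LinearMap.ker_eq_bot, eq_bot_iff]
    intro x hx
    have h1 : i.hom x ∈ N := (Submodule.Quotient.mk_eq_zero N).1 hx
    have h2 := Submodule.disjoint_def.1 hN _ h1 ⟨x, rfl⟩
    exact hi' (h2.trans (map_zero _).symm)
  have hess : ∀ U : Submodule k (Q ⧸ N), U ⊓ LinearMap.range p = ⊥ → U = ⊥ := by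
    intro U hU
    have hUN : U.comap N.mkQ = N := by
      refine hNmax _ ?_ (fun x hx => ?_)
      · rw [Submodule.disjoint_def]
        rintro _ hx ⟨x, rfl⟩
        have : p x ∈ U ⊓ LinearMap.range p := ⟨hx, x, rfl⟩
        rw [hU] at this
        rw [hp (this.trans (map_zero p).symm), map_zero]
      · have : N.mkQ x = 0 := (Submodule.Quotient.mk_eq_zero N).2 hx
        simp [this]
    rw [eq_bot_iff]
    intro x hx
    obtain ⟨y, rfl⟩ := N.mkQ_surjective x
    have : y ∈ U.comap N.mkQ := hx
    rw [hUN] at this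
    exact (Submodule.Quotient.mk_eq_zero N).2 this
  have hQN : SocleMultiplicityFree k (Q ⧸ N) := by
    intro T _ _ hT
    let c : (T →ₗ[k] E) →ₗ[k] (T →ₗ[k] (Q ⧸ N)) := LinearMap.compRight k p
    have hc : Function.Surjective c := by
      intro f
      rcases eq_or_ne f 0 with rfl | hf
      · exact ⟨0, by simp⟩
      have hfi := f.injective_of_ne_zero hf
      have hle : LinearMap.range f ≤ LinearMap.range p := by
        rcases eq_bot_or_eq_top ((LinearMap.range p).comap f) with h | h
        · exfalso
          refine hf (LinearMap.range_eq_bot.1 (hess _ ?_))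
          rw [eq_bot_iff]
          rintro _ ⟨⟨x, rfl⟩, hx⟩
          have : x ∈ (LinearMap.range p).comap f := hx
          rw [h] at this
          rw [(Submodule.mem_bot k).1 this]
          simp
        · rintro _ ⟨x, rfl⟩
          have : x ∈ (LinearMap.range p).comap f := h ▸ trivial
          exact this
      let e := LinearEquiv.ofInjective p hp
      refine ⟨e.symm.toLinearMap ∘ₗ f.codRestrict _ (fun x => hle ⟨x, rfl⟩), ?_⟩
      ext x
      have := congrArg Subtype.val (e.apply_symm_apply ⟨f x, hle ⟨x, rfl⟩⟩)
      exact this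
    exact (Module.length_le_of_surjective c hc).trans (hE T hT)
  have hps : Function.Surjective p := by
    by_contra hps
    have hne : LinearMap.range p ≠ ⊤ := fun h => hps (LinearMap.range_eq_top.1 h)
    have hfin : Module.length k (Q ⧸ N) ≠ ⊤ := ne_top_of_le_ne_top hE_fin (hmax _ hQN)
    obtain ⟨_, _⟩ := isFiniteLength_iff_isNoetherian_isArtinian.1
      (Module.length_ne_top_iff.1 hfin)
    have h1 := Submodule.length_lt hne
    rw [← (LinearEquiv.ofInjective p hp).length_eq] at h1
    exact absurd (hmax _ hQN) (not_le.2 h1)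
  let e := LinearEquiv.ofBijective p ⟨hp, hps⟩
  have : Injective (ModuleCat.of k E) :=
    (Retract.mk i (ModuleCat.ofHom (e.symm.toLinearMap ∘ₗ N.mkQ)) (by
      ext x
      exact e.symm_apply_apply x)).injective
  exact Module.injective_module_of_injective_object k E

theorem exists_linearMap_apply_ne_zero (hinj : Module.Injective k E)
    (hsimple : ∀ (T : Type u) [AddCommGroup T] [Module k T] [IsSimpleModule k T],
      ∃ f : T →ₗ[k] E, f ≠ 0)
    {M : Type u} [AddCommGroup M] [Module k M] {x : M} (hx : x ≠ 0) :
    ∃ f : M →ₗ[k] E, f x ≠ 0 := by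
  have hI : Ideal.torsionOf k M x ≠ ⊤ := fun h => hx ((Ideal.torsionOf_eq_top_iff k x).1 h)
  obtain ⟨m, hm, hle⟩ := Ideal.exists_le_maximal _ hI
  have : IsSimpleModule k (k ⧸ m) := isSimpleModule_iff_isCoatom.2 hm.out
  obtain ⟨f, hf⟩ := hsimple (k ⧸ m)
  have hf1 : f (Submodule.Quotient.mk 1) ≠ 0 := by
    intro h
    refine hf (LinearMap.ext fun y => ?_)
    obtain ⟨y, rfl⟩ := Submodule.Quotient.mk_surjective m y
    have : (Submodule.Quotient.mk y : k ⧸ m) = y • Submodule.Quotient.mk 1 := by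
      rw [← Submodule.Quotient.mk_smul, smul_eq_mul, mul_one]
    rw [this, map_smul, h, smul_zero, LinearMap.zero_apply]
  let g : (k ∙ x) →ₗ[k] E := f ∘ₗ Submodule.factor hle ∘ₗ
    (Ideal.quotTorsionOfEquivSpanSingleton k M x).symm.toLinearMap
  obtain ⟨h, hh⟩ := hinj.out (k ∙ x).subtype Subtype.val_injective g
  refine ⟨h, ?_⟩
  have h1 := hh ⟨x, Submodule.mem_span_singleton_self x⟩
  have h2 : (Ideal.quotTorsionOfEquivSpanSingleton k M x).symm
      ⟨x, Submodule.mem_span_singleton_self x⟩ = Submodule.Quotient.mk 1 := by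
    rw [LinearEquiv.symm_apply_eq, Ideal.quotTorsionOfEquivSpanSingleton_apply_mk, one_smul]
  have h3 : g ⟨x, Submodule.mem_span_singleton_self x⟩ = f (Submodule.Quotient.mk 1) := by
    simp only [g, LinearMap.comp_apply, LinearEquiv.coe_coe, h2]
    rfl
  rw [h3] at h1
  exact h1.trans_ne hf1

variable (k) in
/-- An artinian commutative ring has an injective cogenerator that induces a duality on modules of
finite length. -/
theorem exists_dualizing_module [IsArtinianRing k] :
    ∃ (E : Type u) (_ : AddCommGroup E) (_ : Module k E), Module.Injective k E ∧
      ∀ (M : Type u) [AddCommGroup M] [Module k M] [Module.Finite k M],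
        Module.Finite k (M →ₗ[k] E) ∧ (∀ x : M, x ≠ 0 → ∃ f : M →ₗ[k] E, f x ≠ 0) ∧
        ∀ ψ : (M →ₗ[k] E) →ₗ[k] E, ∃ x : M, ∀ f : M →ₗ[k] E, ψ f = f x := by
  obtain ⟨E, _, _, hE, hmax⟩ := exists_socleMultiplicityFree_length_maximal k
  have hE_fin : Module.length k E ≠ ⊤ := ne_top_of_le_ne_top Module.length_ne_top hE.length_le
  have hinj := injective_of_length_maximal hE hE_fin hmax
  refine ⟨E, inferInstance, inferInstance, hinj, fun M _ _ _ => ?_⟩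
  have hM : IsFiniteLength k M := Module.length_ne_top_iff.1 Module.length_ne_top
  have hle := hE.length_linearMap_le hM
  have hD : IsFiniteLength k (M →ₗ[k] E) :=
    Module.length_ne_top_iff.1 (ne_top_of_le_ne_top Module.length_ne_top hle)
  have hleD := hE.length_linearMap_le hD
  have hDD : IsFiniteLength k ((M →ₗ[k] E) →ₗ[k] E) :=
    Module.length_ne_top_iff.1 (ne_top_of_le_ne_top (Module.length_ne_top_iff.2 hD) hleD)
  have hcog : ∀ x : M, x ≠ 0 → ∃ f : M →ₗ[k] E, f x ≠ 0 := fun x hx =>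
    exists_linearMap_apply_ne_zero hinj (exists_ne_zero_of_length_maximal hE hE_fin hmax) hx
  obtain ⟨_, _⟩ := isFiniteLength_iff_isNoetherian_isArtinian.1 hD
  obtain ⟨_, _⟩ := isFiniteLength_iff_isNoetherian_isArtinian.1 hDD
  refine ⟨inferInstance, hcog, ?_⟩
  let ev : M →ₗ[k] (M →ₗ[k] E) →ₗ[k] E := LinearMap.applyₗ
  have hev : Function.Injective ev := by
    rw [injective_iff_map_eq_zero]
    intro x hx
    by_contra h
    obtain ⟨f, hf⟩ := hcog x h
    exact hf (LinearMap.congr_fun hx f)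
  have hr : LinearMap.range ev = ⊤ := by
    by_contra h
    have h1 := Submodule.length_lt h
    rw [← (LinearEquiv.ofInjective ev hev).length_eq] at h1
    exact absurd (hleD.trans hle) (not_le.2 h1)
  intro ψ
  obtain ⟨x, rfl⟩ := LinearMap.range_eq_top.1 hr ψ
  exact ⟨x, fun f => rfl⟩

end InjectiveCogenerator

section DualBimodule

/-- If restriction along a functional `ε : J → E` identifies `J` with the coinduced module
`Hom_k(A, E)` and `E` is injective over `k`, then `J` is injective over `A`. -/
theorem injective_of_existsUnique_functional {k A J E : Type u} [CommRing k] [Ring A] [Algebra k A]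
    [AddCommGroup E] [Module k E] [AddCommGroup J] [Module k J] [Module A J] [IsScalarTower k A J]
    (hE : Module.Injective k E) (ε : J →ₗ[k] E)
    (h : ∀ f : A →ₗ[k] E, ∃! j : J, ∀ a : A, ε (a • j) = f a) : Module.Injective A J := by
  refine Module.Baer.injective fun L g => ?_
  obtain ⟨f, hf⟩ := hE.out (L.restrictScalars k).subtype Subtype.val_injective
    (ε ∘ₗ g.restrictScalars k)
  obtain ⟨j, hj, -⟩ := h f
  refine ⟨LinearMap.toSpanSingleton A J j, fun l hl => ?_⟩
  refine (h (f ∘ₗ LinearMap.mulRight k l)).unique (fun a => ?_) fun a => ?_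
  · exact (congrArg ε (mul_smul a l j).symm).trans (hj (a * l))
  · rw [← map_smul]
    exact (hf ⟨a * l, L.mul_mem_left a hl⟩).symm

variable (k Λ E : Type u) [CommRing k] [Ring Λ] [Algebra k Λ] [AddCommGroup E] [Module k E]

/-- The `Λ`-bimodule `Hom_k(Λ, E)`. -/
def DualBimodule : Type u := Λ →ₗ[k] E

namespace DualBimodule

noncomputable instance : AddCommGroup (DualBimodule k Λ E) :=
  inferInstanceAs (AddCommGroup (Λ →ₗ[k] E))

noncomputable instance : Module k (DualBimodule k Λ E) :=
  inferInstanceAs (Module k (Λ →ₗ[k] E))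

instance : FunLike (DualBimodule k Λ E) Λ E :=
  inferInstanceAs (FunLike (Λ →ₗ[k] E) Λ E)

instance : LinearMapClass (DualBimodule k Λ E) k Λ E :=
  inferInstanceAs (LinearMapClass (Λ →ₗ[k] E) k Λ E)

variable {k Λ E}

@[ext]
theorem ext {f g : DualBimodule k Λ E} (h : ∀ x, f x = g x) : f = g := DFunLike.ext f g h

@[simp]
theorem smul_apply (c : k) (f : DualBimodule k Λ E) (x : Λ) : (c • f) x = c • f x := rfl

noncomputable instance : Module Λ (DualBimodule k Λ E) where
  smul a f := (f : Λ →ₗ[k] E) ∘ₗ LinearMap.mulRight k a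
  one_smul f := ext fun x => congrArg f (mul_one x)
  mul_smul a b f := ext fun x => congrArg f (mul_assoc x a b).symm
  smul_zero _ := rfl
  smul_add _ _ _ := rfl
  add_smul a b f := ext fun x => (congrArg f (mul_add x a b)).trans (map_add f _ _)
  zero_smul f := ext fun x => (congrArg f (mul_zero x)).trans (map_zero f)

noncomputable instance : Module Λᵐᵒᵖ (DualBimodule k Λ E) where
  smul a f := (f : Λ →ₗ[k] E) ∘ₗ LinearMap.mulLeft k a.unop
  one_smul f := ext fun x => congrArg f (one_mul x)
  mul_smul a b f := ext fun x => congrArg f (mul_assoc b.unop a.unop x)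
  smul_zero _ := rfl
  smul_add _ _ _ := rfl
  add_smul a b f := ext fun x => (congrArg f (add_mul a.unop b.unop x)).trans (map_add f _ _)
  zero_smul f := ext fun x => (congrArg f (zero_mul x)).trans (map_zero f)

@[simp]
theorem left_smul_apply (a : Λ) (f : DualBimodule k Λ E) (x : Λ) : (a • f) x = f (x * a) := rfl

@[simp]
theorem right_smul_apply (a : Λᵐᵒᵖ) (f : DualBimodule k Λ E) (x : Λ) :
    (a • f) x = f (a.unop * x) := rfl

instance : SMulCommClass Λ Λᵐᵒᵖ (DualBimodule k Λ E) where
  smul_comm a b f := ext fun x => congrArg f (mul_assoc b.unop x a).symm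

instance : IsScalarTower k Λ (DualBimodule k Λ E) where
  smul_assoc c a f := ext fun x => by simp

instance : IsScalarTower k Λᵐᵒᵖ (DualBimodule k Λ E) where
  smul_assoc c a f := ext fun x => by simp

variable (k Λ E) in
/-- Evaluation at `1`. -/
noncomputable def evalOne : DualBimodule k Λ E →ₗ[k] E where
  toFun f := f 1
  map_add' _ _ := rfl
  map_smul' _ _ := rfl

theorem injective_left (hE : Module.Injective k E) : Module.Injective Λ (DualBimodule k Λ E) := by
  refine injective_of_existsUnique_functional hE (evalOne k Λ E) fun f =>
    ⟨f, fun a => congrArg f (one_mul a), fun g hg => ext fun x => ?_⟩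
  refine Eq.trans ?_ (hg x)
  exact congrArg g (one_mul x).symm

theorem injective_right (hE : Module.Injective k E) :
    Module.Injective Λᵐᵒᵖ (DualBimodule k Λ E) := by
  refine injective_of_existsUnique_functional hE (evalOne k Λ E) fun f =>
    ⟨f ∘ₗ (MulOpposite.opLinearEquiv k).toLinearMap,
      fun a => congrArg (fun y => f (MulOpposite.op y)) (mul_one a.unop),
      fun g hg => ext fun x => ?_⟩
  refine Eq.trans ?_ (hg (MulOpposite.op x))
  exact congrArg g (mul_one x).symm

theorem finite_left (h : Module.Finite k (Λ →ₗ[k] E)) : Module.Finite Λ (DualBimodule k Λ E) :=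
  have : Module.Finite k (DualBimodule k Λ E) := h
  Module.Finite.of_restrictScalars_finite k Λ _

/-- `Λᵐᵒᵖ` is the endomorphism ring of the left module `Hom_k(Λ, E)`. -/
noncomputable def opEquivEnd (hsep : ∀ x : Λ, x ≠ 0 → ∃ f : Λ →ₗ[k] E, f x ≠ 0)
    (hbidual : ∀ ψ : (Λ →ₗ[k] E) →ₗ[k] E, ∃ x : Λ, ∀ f : Λ →ₗ[k] E, ψ f = f x) :
    Λᵐᵒᵖ ≃ₗ[Λᵐᵒᵖ] (DualBimodule k Λ E →ₗ[Λ] DualBimodule k Λ E) :=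
  LinearEquiv.ofBijective
    (LinearMap.toSpanSingleton Λᵐᵒᵖ (DualBimodule k Λ E →ₗ[Λ] DualBimodule k Λ E) LinearMap.id) (by
      constructor
      · rw [injective_iff_map_eq_zero]
        intro a ha
        by_contra h
        obtain ⟨f, hf⟩ := hsep a.unop (by simpa using h)
        refine hf ?_
        have h1 : a • (show DualBimodule k Λ E from f) = 0 := LinearMap.congr_fun ha f
        exact (congrArg f (mul_one a.unop)).symm.trans (DFunLike.congr_fun h1 1)
      · intro φ
        obtain ⟨x, hx⟩ := hbidual (evalOne k Λ E ∘ₗ φ.restrictScalars k)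
        refine ⟨MulOpposite.op x, LinearMap.ext fun f => ext fun a => ?_⟩
        have h1 := hx (a • f : DualBimodule k Λ E)
        have h2 : φ (a • f) 1 = f (x * a) := h1
        rw [map_smul, left_smul_apply, one_mul] at h2
        exact h2.symm)

end DualBimodule

end DualBimodule

section DualityDimension

variable {A B J : Type u} [Ring A] [Ring B] [AddCommGroup J] [Module A J] [Module B J]
  [SMulCommClass A B J]

theorem injective_linearMap_of_projective (hJ : Module.Injective B J) (X : Type u)
    [AddCommGroup X] [Module A X] [Module.Projective A X] :
    Injective (ModuleCat.of B (X →ₗ[A] J)) := by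
  obtain ⟨s, hs⟩ := (Module.projective_def (R := A) (P := X)).1 ‹_›
  let p := Finsupp.linearCombination A (id : X → X)
  have : Injective (ModuleCat.of B (X → J)) := Module.injective_object_of_injective_module B _
  let e : ModuleCat.of B (X → J) ≅ ModuleCat.of B ((X →₀ A) →ₗ[A] J) :=
    (Finsupp.llift J A B X).toModuleIso
  have : Injective (ModuleCat.of B ((X →₀ A) →ₗ[A] J)) := Injective.of_iso e this
  refine (Retract.mk (Y := ModuleCat.of B ((X →₀ A) →ₗ[A] J))
    (ModuleCat.ofHom (LinearMap.lcomp B J p)) (ModuleCat.ofHom (LinearMap.lcomp B J s))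
    ?_).injective
  ext f x
  exact congrArg f (hs x)

theorem hasInjectiveDimensionLT_linearMap (hA : Module.Injective A J) (hB : Module.Injective B J)
    (d : ℕ) (X : ModuleCat.{u} A) [HasProjectiveDimensionLT X (d + 1)] :
    HasInjectiveDimensionLT (ModuleCat.of B (X →ₗ[A] J)) (d + 1) := by
  induction d generalizing X with
  | zero =>
    have : Projective X := projective_iff_hasProjectiveDimensionLT_one.2 ‹_›
    have : Module.Projective A X := (IsProjective.iff_projective X).2 ‹_›
    have := injective_linearMap_of_projective (A := A) hB X
    infer_instance
  | succ d ih =>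
    let p := Finsupp.linearCombination A (id : X → X)
    have hp : Function.Surjective p := Finsupp.linearCombination_id_surjective A X
    have hS := LinearMap.shortExact_shortComplexKer hp
    have hF : Projective (ModuleCat.of A (X →₀ A)) :=
      (IsProjective.iff_projective _).1 inferInstance
    have hK : HasProjectiveDimensionLT (ModuleCat.of A (LinearMap.ker p)) (d + 1) :=
      (hS.hasProjectiveDimensionLT_X₃_iff d hF).1 ‹_›
    have h3 := ih (ModuleCat.of A (LinearMap.ker p))
    have := injective_linearMap_of_projective (A := A) hB (X →₀ A)
    let f : (X →ₗ[A] J) →ₗ[B] ((X →₀ A) →ₗ[A] J) := LinearMap.lcomp B J p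
    let g : ((X →₀ A) →ₗ[A] J) →ₗ[B] (LinearMap.ker p →ₗ[A] J) :=
      LinearMap.lcomp B J (LinearMap.ker p).subtype
    have hf : Function.Injective f := fun a b hab => by
      ext x
      obtain ⟨y, rfl⟩ := hp x
      exact LinearMap.congr_fun hab y
    have hg : Function.Surjective g := fun a => by
      obtain ⟨b, hb⟩ := hA.out (X := LinearMap.ker p) (LinearMap.ker p).subtype
        Subtype.val_injective a
      exact ⟨b, LinearMap.ext hb⟩
    have hfg : Function.Exact f g := by
      intro a
      constructor
      · intro ha
        have hle : LinearMap.ker p ≤ LinearMap.ker a :=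
          fun y hy => LinearMap.congr_fun ha ⟨y, hy⟩
        refine ⟨(LinearMap.ker p).liftQ a hle ∘ₗ
          (p.quotKerEquivOfSurjective hp).symm.toLinearMap, LinearMap.ext fun y => ?_⟩
        exact congrArg ((LinearMap.ker p).liftQ a hle)
          (p.quotKerEquivOfSurjective_symm_apply hp y)
      · rintro ⟨b, rfl⟩
        ext x
        exact (congrArg b x.2).trans (map_zero b)
    have hS' := ModuleCat.shortComplex_shortExact
      (ModuleCat.shortComplexOfCompEqZero f g hfg.linearMap_comp_eq_zero) hfg hf hg
    exact hS'.hasInjectiveDimensionLT_X₁ (d + 1)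
      h3 inferInstance

end DualityDimension

section AuslanderCondition

variable {A : Type u} [Ring A]

theorem injDimLE_iff (N : ModuleCat.{u} A) (n : ℕ) :
    InjDimLE N n ↔ HasInjectiveDimensionLT N (n + 1) := by
  rw [hasInjectiveDimensionLT_iff.{u}]
  constructor
  · rintro h (_ | i) hi M e
    · simp at hi
    · have := (subsingleton_extGroup_succ_iff M N i).1 (h M (i + 1) hi)
      exact Subsingleton.elim _ _
  · rintro h M (_ | i) hi
    · simp at hi
    · exact (subsingleton_extGroup_succ_iff M N i).2
        ⟨fun x y => by rw [h (i + 1) hi x, h (i + 1) hi y]⟩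

theorem projDimLE_iff (M : ModuleCat.{u} A) (n : ℕ) :
    ProjDimLE M n ↔ HasProjectiveDimensionLT M (n + 1) := by
  rw [hasProjectiveDimensionLT_iff.{u}]
  constructor
  · rintro h (_ | i) hi N e
    · simp at hi
    · have := (subsingleton_extGroup_succ_iff M N i).1 (h N (i + 1) hi)
      exact Subsingleton.elim _ _
  · rintro h N (_ | i) hi
    · simp at hi
    · exact (subsingleton_extGroup_succ_iff M N i).2
        ⟨fun x y => by rw [h (i + 1) hi x, h (i + 1) hi y]⟩

/-- A noetherian ring of finite self-injective dimension has finite finitistic dimension. -/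
theorem FiniteFinitisticDim.of_injDimLE [IsNoetherianRing A] {n : ℕ}
    (h : InjDimLE (ModuleCat.of A A) n) : FiniteFinitisticDim A := by
  refine ⟨n, fun M _ ⟨m, hm⟩ => ?_⟩
  rw [injDimLE_iff] at h
  rw [projDimLE_iff] at hm ⊢
  exact hasProjectiveDimensionLT_of_hasInjectiveDimensionLT_self n (m + 1) M

/-- Under Auslander's condition, finite self-injective dimension forces finitely generated
injective modules to have finite projective dimension. -/
theorem SatisfiesAC.exists_hasProjectiveDimensionLT [IsNoetherianRing A] (hAC : SatisfiesAC A)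
    {n : ℕ} (h : InjDimLE (ModuleCat.of A A) n) (J : ModuleCat.{u} A) [Module.Finite A J]
    [Injective J] : ∃ b : ℕ, HasProjectiveDimensionLT J (b + 1) := by
  rw [injDimLE_iff] at h
  obtain ⟨b, hb⟩ := hAC J ‹_›
  refine ⟨b, hasProjectiveDimensionLT_of_subsingleton_ext
    (fun N => ∃ m, HasInjectiveDimensionLT N (m + 1)) ?_ b J ⟨0, inferInstance⟩ ?_⟩
  · rintro S hS _ _ ⟨m, hm⟩
    have := hasInjectiveDimensionLT_of_free (n + 1) S.X₂
    refine ⟨m + 1 + n, hS.hasInjectiveDimensionLT_X₁ (m + 1 + n) ?_ ?_⟩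
    · exact hasInjectiveDimensionLT_of_ge _ (m + 1) _ (by lia)
    · exact hasInjectiveDimensionLT_of_ge _ (n + 1) _ (by lia)
  · rintro N _ ⟨m, hm⟩
    rw [← injDimLE_iff] at hm
    exact (subsingleton_extGroup_succ_iff J N b).1
      (hb N ‹_› ⟨m + 1, fun i hi => hm J i hi⟩ (b + 1) (Nat.lt_succ_self b))

end AuslanderCondition

theorem stmt3 (k : Type u) (Λ : Type u) [CommRing k] [IsArtinianRing k]
    [Ring Λ] [Algebra k Λ] [Module.Finite k Λ]
    (hAC : SatisfiesAC Λ)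
    (hid : ∃ n : ℕ, InjDimLE (ModuleCat.of Λ Λ) n) :
    (∃ n : ℕ, InjDimLE (ModuleCat.of Λᵐᵒᵖ Λᵐᵒᵖ) n) ∧
    FiniteFinitisticDim Λ ∧ FiniteFinitisticDim Λᵐᵒᵖ := by
  obtain ⟨n, hn⟩ := hid
  have : IsNoetherianRing Λ := IsNoetherianRing.of_finite k Λ
  have : Module.Finite k Λᵐᵒᵖ := Module.Finite.equiv (MulOpposite.opLinearEquiv k)
  have : IsNoetherianRing Λᵐᵒᵖ := IsNoetherianRing.of_finite k Λᵐᵒᵖ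
  obtain ⟨E, _, _, hE, hdual⟩ := exists_dualizing_module k
  obtain ⟨hfin, hsep, hbidual⟩ := hdual Λ
  have hleft := DualBimodule.injective_left (Λ := Λ) hE
  have := Module.injective_object_of_injective_module Λ (DualBimodule k Λ E)
  have := DualBimodule.finite_left hfin
  obtain ⟨b, _⟩ := hAC.exists_hasProjectiveDimensionLT hn (ModuleCat.of Λ (DualBimodule k Λ E))
  have := hasInjectiveDimensionLT_linearMap hleft (DualBimodule.injective_right (Λ := Λ) hE) b
    (ModuleCat.of Λ (DualBimodule k Λ E))
  have hop : InjDimLE (ModuleCat.of Λᵐᵒᵖ Λᵐᵒᵖ) b := by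
    rw [injDimLE_iff]
    exact hasInjectiveDimensionLT_of_iso
      (DualBimodule.opEquivEnd hsep hbidual).symm.toModuleIso (b + 1)
  exact ⟨⟨b, hop⟩, .of_injDimLE hn, .of_injDimLE hop⟩
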